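/- Let β* = ψ. Then among all regularized channel inversion beamformers, the one with regularization parameter β* maximizes the SINR: for every β > 0, writing f(β) = (B₀ + βI)⁻¹ h_k and f̂(β) = f(β)/‖f(β)‖, one has γ_k(f̂(ψ)) ≥ γ_k(f̂(β)). (This is the paper's Theorem 1: the optimal regularization parameter is the normalized noise power ψ when the beamformer is normalized to unit power.) -/

import Mathlib

open Matrix BigOperators

/-- The SINR of subcarrier `k`: `γ_k(f) = c_k |h_kᴴ f|² / (∑_{λ ≠ k} c_λ |h_λᴴ f|² + ψ)`. -/
noncomputable def sinr {K n : ℕ} (h : Fin K → Fin n → ℂ) (c : Fin K → ℝ) (ψ : ℝ)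
    (k : Fin K) (f : Fin n → ℂ) : ℝ :=
  c k * ‖star (h k) ⬝ᵥ f‖ ^ 2 /
    (∑ l ∈ Finset.univ.erase k, c l * ‖star (h l) ⬝ᵥ f‖ ^ 2 + ψ)

noncomputable def phiAux {K n : ℕ} (h : Fin K → Fin n → ℂ) (c : Fin K → ℝ) (ψ : ℝ)
    (u : Fin n → ℂ) : EuclideanSpace ℂ (Fin K ⊕ Fin n) :=
  WithLp.toLp 2 (Sum.elim (fun l => (Real.sqrt (c l) : ℂ) * (star (h l) ⬝ᵥ u))
    (fun i => (Real.sqrt ψ : ℂ) * u i))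

lemma phiAux_norm {K n : ℕ} (h : Fin K → Fin n → ℂ) (c : Fin K → ℝ) (hc : ∀ l, 0 ≤ c l)
    (ψ : ℝ) (hψ : 0 < ψ) (u : Fin n → ℂ) :
    ‖phiAux h c ψ u‖ ^ 2 =
      ∑ l, c l * ‖star (h l) ⬝ᵥ u‖ ^ 2 + ψ * ∑ i, ‖u i‖ ^ 2 := by
  rw [EuclideanSpace.norm_sq_eq, Fintype.sum_sum_type, Finset.mul_sum]
  simp only [phiAux, Sum.elim_inl, Sum.elim_inr, norm_mul, mul_pow, Complex.norm_real,
    Real.norm_eq_abs, sq_abs, Real.sq_sqrt (hc _), Real.sq_sqrt hψ.le]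

lemma phiAux_inner {K n : ℕ} (h : Fin K → Fin n → ℂ) (c : Fin K → ℝ) (hc : ∀ l, 0 ≤ c l)
    (ψ : ℝ) (hψ : 0 < ψ) (w g v : Fin n → ℂ)
    (hw : v = ∑ l, ((c l : ℂ) * (star (h l) ⬝ᵥ w)) • h l + (ψ : ℂ) • w) :
    inner ℂ (phiAux h c ψ w) (phiAux h c ψ g) = star v ⬝ᵥ g := by
  have e : ∀ a : ℝ, 0 ≤ a → (Real.sqrt a : ℂ) * (Real.sqrt a : ℂ) = (a : ℂ) := by
    intro a ha
    rw [← Complex.ofReal_mul, Real.mul_self_sqrt ha]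
  rw [PiLp.inner_apply, Fintype.sum_sum_type, hw, star_add, star_sum, add_dotProduct,
    sum_dotProduct]
  congr 1
  · refine Finset.sum_congr rfl fun l _ => ?_
    simp only [phiAux, Sum.elim_inl, RCLike.inner_apply, star_smul, smul_dotProduct, map_mul,
      star_mul', Complex.conj_ofReal, smul_eq_mul, RCLike.star_def]
    rw [← e (c l) (hc l)]
    ring
  · rw [star_smul, smul_dotProduct, dotProduct, smul_eq_mul, Finset.mul_sum]
    refine Finset.sum_congr rfl fun l _ => ?_
    simp only [phiAux, Sum.elim_inr, RCLike.inner_apply, map_mul, Complex.conj_ofReal,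
      RCLike.star_def, Pi.star_apply]
    rw [← e ψ hψ.le]
    ring

lemma sinr_normalized {K n : ℕ} (h : Fin K → Fin n → ℂ) (c : Fin K → ℝ)
    (ψ : ℝ) (k : Fin K) (g : Fin n → ℂ) :
    sinr h c ψ k (((Real.sqrt (∑ i, ‖g i‖ ^ 2) : ℂ))⁻¹ • g) =
      c k * ‖star (h k) ⬝ᵥ g‖ ^ 2 /
        (∑ l ∈ Finset.univ.erase k, c l * ‖star (h l) ⬝ᵥ g‖ ^ 2 + ψ * ∑ i, ‖g i‖ ^ 2) := by
  have hN : 0 ≤ ∑ i, ‖g i‖ ^ 2 := by positivity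
  have key : ∀ l, ‖star (h l) ⬝ᵥ (((Real.sqrt (∑ i, ‖g i‖ ^ 2) : ℂ))⁻¹ • g)‖ ^ 2 =
      (∑ i, ‖g i‖ ^ 2)⁻¹ * ‖star (h l) ⬝ᵥ g‖ ^ 2 := by
    intro l
    rw [dotProduct_smul, norm_smul, mul_pow, norm_inv, inv_pow, Complex.norm_real,
      Real.norm_eq_abs, sq_abs, Real.sq_sqrt hN]
  unfold sinr
  simp only [key]
  rcases hN.eq_or_lt with h0 | hpos
  · have hg : g = 0 := by
      funext i
      have := (Finset.sum_eq_zero_iff_of_nonneg (fun i _ => by positivity)).1 h0.symm i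
        (Finset.mem_univ i)
      simpa using this
    subst hg
    simp
  · generalize (∑ i, ‖g i‖ ^ 2) = N at *
    have : ∑ l ∈ Finset.univ.erase k, c l * (N⁻¹ * ‖star (h l) ⬝ᵥ g‖ ^ 2) + ψ =
       N⁻¹ * (∑ l ∈ Finset.univ.erase k, c l * ‖star (h l) ⬝ᵥ g‖ ^ 2 + ψ * N) := by
      rw [mul_add, Finset.mul_sum]
      congr 1
      · exact Finset.sum_congr rfl fun l _ => by ring
      · field_simp
    rw [this, show c k * (N⁻¹ * ‖star (h k) ⬝ᵥ g‖ ^ 2) =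
      N⁻¹ * (c k * ‖star (h k) ⬝ᵥ g‖ ^ 2) by ring]
    exact mul_div_mul_left _ _ (inv_pos.2 hpos).ne'

open scoped ComplexOrder in
lemma solve_aux {K n : ℕ} (h : Fin K → Fin n → ℂ) (c : Fin K → ℝ) (hc : ∀ l, 0 ≤ c l)
    (ψ : ℝ) (hψ : 0 < ψ) (v : Fin n → ℂ) (B₀ : Matrix (Fin n) (Fin n) ℂ)
    (hB₀ : B₀ = ∑ l, (c l : ℂ) • vecMulVec (h l) (star (h l))) (w : Fin n → ℂ)
    (hw : w = (B₀ + (ψ : ℂ) • 1)⁻¹ *ᵥ v) :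
    v = ∑ l, ((c l : ℂ) * (star (h l) ⬝ᵥ w)) • h l + (ψ : ℂ) • w := by
  have hP : (B₀ + (ψ : ℂ) • (1 : Matrix (Fin n) (Fin n) ℂ)).PosDef := by
    refine PosDef.posSemidef_add ?_ (PosDef.one.smul (by exact_mod_cast hψ))
    rw [hB₀]
    refine posSemidef_sum _ fun l _ => (posSemidef_vecMulVec_self_star (h l)).smul ?_
    exact_mod_cast hc l
  have hv : (B₀ + (ψ : ℂ) • (1 : Matrix (Fin n) (Fin n) ℂ)) *ᵥ w = v := by
    rw [hw, mulVec_mulVec, mul_nonsing_inv _ ((isUnit_iff_isUnit_det _).1 hP.isUnit),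
      one_mulVec]
  rw [← hv, add_mulVec, smul_mulVec, one_mulVec, hB₀, sum_mulVec]
  congr 1
  refine Finset.sum_congr rfl fun l _ => ?_
  rw [smul_mulVec, vecMulVec_mulVec, mul_smul]
  simp

/-- **Theorem 1 of the paper.**  Among all regularized channel inversion beamformers
`f(β) = (B₀ + βI)⁻¹ h_k` (normalized to unit Euclidean norm as `f̂(β)`), the
regularization parameter `β* = ψ` (the normalized noise power) maximizes the SINR:
for every `β > 0`, `γ_k(f̂(ψ)) ≥ γ_k(f̂(β))`.  Here
`B₀ = ∑_{λ=1}^{K} c_λ h_λ h_λᴴ`, `c_λ ≥ 0`, `c_k > 0`, and `ψ > 0`. -/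
theorem stmt_0 {K n : ℕ} (hK : 1 ≤ K) (hn : 1 ≤ n) (k : Fin K)
    (h : Fin K → Fin n → ℂ) (c : Fin K → ℝ) (hc : ∀ l, 0 ≤ c l) (hck : 0 < c k)
    (ψ : ℝ) (hψ : 0 < ψ)
    (B₀ : Matrix (Fin n) (Fin n) ℂ)
    (hB₀ : B₀ = ∑ l, (c l : ℂ) • vecMulVec (h l) (star (h l)))
    (f : ℝ → Fin n → ℂ)
    (hf : ∀ β : ℝ, f β = (B₀ + (β : ℂ) • 1)⁻¹ *ᵥ h k)
    (fhat : ℝ → Fin n → ℂ)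
    (hfhat : ∀ β : ℝ, fhat β =
      ((Real.sqrt (∑ i, ‖f β i‖ ^ 2) : ℂ))⁻¹ • f β) :
    ∀ β : ℝ, 0 < β → sinr h c ψ k (fhat β) ≤ sinr h c ψ k (fhat ψ) := by
  intro β _
  rw [hfhat, hfhat, sinr_normalized, sinr_normalized]
  have hs := solve_aux h c hc ψ hψ (h k) B₀ hB₀ (f ψ) (hf ψ)
  generalize f ψ = w at *
  generalize f β = g at *
  have hg := phiAux_norm h c hc ψ hψ g
  have hw := phiAux_norm h c hc ψ hψ w
  have ig := phiAux_inner h c hc ψ hψ w g (h k) hs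
  have iw := phiAux_inner h c hc ψ hψ w w (h k) hs
  have cs := norm_inner_le_norm (𝕜 := ℂ) (phiAux h c ψ w) (phiAux h c ψ g)
  rw [ig] at cs
  have cs2 : ‖star (h k) ⬝ᵥ g‖ ^ 2 ≤ ‖phiAux h c ψ w‖ ^ 2 * ‖phiAux h c ψ g‖ ^ 2 := by
    rw [← mul_pow]; gcongr
  have iw2 : ‖star (h k) ⬝ᵥ w‖ = ‖phiAux h c ψ w‖ ^ 2 := by
    rw [← iw, inner_self_eq_norm_sq_to_K]
    simp
  rw [← Finset.add_sum_erase _ _ (Finset.mem_univ k), add_assoc] at hg hw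
  have Eg : 0 ≤ ∑ l ∈ Finset.univ.erase k, c l * ‖star (h l) ⬝ᵥ g‖ ^ 2 + ψ * ∑ i, ‖g i‖ ^ 2 :=
    add_nonneg (Finset.sum_nonneg fun l _ => mul_nonneg (hc l) (by positivity)) (by positivity)
  have Ew1 : 0 ≤ ∑ l ∈ Finset.univ.erase k, c l * ‖star (h l) ⬝ᵥ w‖ ^ 2 :=
    Finset.sum_nonneg fun l _ => mul_nonneg (hc l) (by positivity)
  have hN : 0 ≤ ∑ i, ‖w i‖ ^ 2 := by positivity
  have Ew : 0 ≤ ∑ l ∈ Finset.univ.erase k, c l * ‖star (h l) ⬝ᵥ w‖ ^ 2 + ψ * ∑ i, ‖w i‖ ^ 2 :=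
    add_nonneg Ew1 (by positivity)
  rcases Eg.eq_or_lt with h0 | Eg'
  · rw [← h0, div_zero]; positivity
  rcases Ew.eq_or_lt with h0 | Ew'
  · have hw0 : w = 0 := by
      have h1 : ∑ i, ‖w i‖ ^ 2 = 0 := by nlinarith
      funext i
      have := (Finset.sum_eq_zero_iff_of_nonneg (fun i _ => by positivity)).1 h1 i
        (Finset.mem_univ i)
      simpa using this
    have : ‖star (h k) ⬝ᵥ g‖ ^ 2 ≤ 0 := by
      rw [← iw2, hw0] at cs2
      simpa using cs2
    have h2 : ‖star (h k) ⬝ᵥ g‖ ^ 2 = 0 := le_antisymm this (by positivity)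
    rw [h2, mul_zero, zero_div]; positivity
  rw [div_le_div_iff₀ Eg' Ew']
  rw [iw2] at hw ⊢
  rw [hg] at cs2
  generalize (∑ l ∈ Finset.univ.erase k, c l * ‖star (h l) ⬝ᵥ g‖ ^ 2 + ψ * ∑ i, ‖g i‖ ^ 2) = E at *
  generalize (∑ l ∈ Finset.univ.erase k, c l * ‖star (h l) ⬝ᵥ w‖ ^ 2 + ψ * ∑ i, ‖w i‖ ^ 2) = F at *
  have hq : 0 ≤ ‖phiAux h c ψ w‖ ^ 2 := by positivity
  generalize ‖phiAux h c ψ w‖ ^ 2 = q at *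
  generalize ‖star (h k) ⬝ᵥ g‖ ^ 2 = x at *
  have hF : F = q - c k * q ^ 2 := by linarith
  have := mul_le_mul_of_nonneg_left cs2 (mul_nonneg hck.le hq)
  rw [hF]
  linarith
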